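/- For all m, k ∈ ℕ the following identity holds in K[x]: B_q(k) composed with the polynomial q^m·x + [m]_q equals Σ_{i=0}^{min(m,k)} q^{(m−i)(k−i)}·qbinom(m,i)·B_q(k−i). (This describes the action of the m-th power of the shift operator S, S(x) = qx+1, on the basis of q-binomial coefficient polynomials, since S^m(x) = q^m x + [m]_q.) -/

import Mathlib

open Polynomial

noncomputable section

/-- `K = ℚ(q)`, the field of rational functions in `q` over `ℚ`. -/
abbrev K : Type := RatFunc ℚ

/-- The variable `q ∈ K`. -/
def qq : K := RatFunc.X

/-- The quantum integer `[n]_q = (q^n - 1)/(q - 1) ∈ K`. -/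
def qInt (n : ℤ) : K := (qq ^ n - 1) / (qq - 1)

/-- The quantum factorial `[n]_q! = ∏_{i=1}^n [i]_q`. -/
def qFact (n : ℕ) : K := ∏ i ∈ Finset.range n, qInt ((i : ℤ) + 1)

/-- The Gaussian binomial coefficient `qbinom(n,k) ∈ K`. -/
def qBinom (n k : ℕ) : K := if k ≤ n then qFact n / (qFact k * qFact (n - k)) else 0

/-- The `q`-binomial coefficient polynomial `B_q(k) ∈ K[x]`, with `B_q(0) = 1`. -/
def Bq (k : ℕ) : K[X] :=
  C ((qq ^ (k.choose 2) * qFact k)⁻¹) * ∏ i ∈ Finset.range k, (X - C (qInt i))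

theorem qq_ne_zero : qq ≠ 0 := RatFunc.X_ne_zero

theorem qq_pow_ne_one (n : ℕ) : qq ^ (n + 1) ≠ 1 := by
  intro h
  have h1 : algebraMap ℚ[X] (RatFunc ℚ) (X ^ (n + 1)) = algebraMap ℚ[X] (RatFunc ℚ) 1 := by
    simpa [qq] using h
  have h2 := RatFunc.algebraMap_injective ℚ h1
  have h3 := congrArg natDegree h2
  simp at h3

theorem qq_sub_ne : qq - 1 ≠ 0 := by
  have := qq_pow_ne_one 0
  simpa [sub_eq_zero] using this

theorem qInt_nat (n : ℕ) : qInt (n : ℤ) = (qq ^ n - 1) / (qq - 1) := by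
  simp [qInt]

theorem qInt_zero : qInt ((0 : ℕ) : ℤ) = 0 := by
  simp [qInt]

theorem qInt_succ (n : ℕ) : qInt ((n + 1 : ℕ) : ℤ) = 1 + qq * qInt (n : ℤ) := by
  rw [qInt_nat, qInt_nat]
  have := qq_sub_ne
  field_simp
  ring

theorem qInt_succ' (n : ℕ) : qInt ((n + 1 : ℕ) : ℤ) = qq ^ n + qInt (n : ℤ) := by
  rw [qInt_nat, qInt_nat]
  have := qq_sub_ne
  field_simp
  ring

theorem qInt_add (a b : ℕ) :
    qInt ((a + b : ℕ) : ℤ) = qInt (a : ℤ) + qq ^ a * qInt (b : ℤ) := by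
  rw [qInt_nat, qInt_nat, qInt_nat]
  have := qq_sub_ne
  field_simp
  ring

theorem qInt_succ_ne (n : ℕ) : qInt ((n + 1 : ℕ) : ℤ) ≠ 0 := by
  rw [qInt_nat]
  exact div_ne_zero (sub_ne_zero.2 (qq_pow_ne_one n)) qq_sub_ne

theorem qFact_zero : qFact 0 = 1 := by simp [qFact]

theorem qFact_succ (n : ℕ) : qFact (n + 1) = qFact n * qInt ((n + 1 : ℕ) : ℤ) := by
  simp [qFact, Finset.prod_range_succ]

theorem qFact_ne (n : ℕ) : qFact n ≠ 0 := by
  induction n with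
  | zero => simp [qFact_zero]
  | succ n ih => rw [qFact_succ]; exact mul_ne_zero ih (qInt_succ_ne n)

theorem qBinom_zero (m : ℕ) : qBinom m 0 = 1 := by
  simp [qBinom, qFact_zero, qFact_ne]

theorem qBinom_self (m : ℕ) : qBinom m m = 1 := by
  simp [qBinom, qFact_zero, qFact_ne]

theorem qBinom_big (m : ℕ) : qBinom m (m + 1) = 0 := by
  simp [qBinom]

theorem qBinom_pascal (m i : ℕ) (h : i ≤ m) :
    qBinom (m + 1) (i + 1) = qBinom m (i + 1) + qq ^ (m - i) * qBinom m i := by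
  obtain ⟨d, rfl⟩ := Nat.exists_eq_add_of_le h
  cases d with
  | zero => simp [qBinom_self, qBinom_big]
  | succ d =>
    have e1 : i + (d + 1) + 1 - (i + 1) = d + 1 := by omega
    have e2 : i + (d + 1) - (i + 1) = d := by omega
    have e3 : i + (d + 1) - i = d + 1 := by omega
    have e4 : qInt ((i + (d + 1) + 1 : ℕ) : ℤ)
        = qInt ((d + 1 : ℕ) : ℤ) + qq ^ (d + 1) * qInt ((i + 1 : ℕ) : ℤ) := by
      rw [← qInt_add]; congr 2; omega
    unfold qBinom
    rw [if_pos (by omega), if_pos (by omega), if_pos (by omega), e1, e2, e3,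
      qFact_succ (i + (d + 1)), qFact_succ i, qFact_succ d, e4]
    have h1 := qFact_ne i
    have h2 := qFact_ne d
    have h3 := qInt_succ_ne i
    have h4 := qInt_succ_ne d
    generalize qInt ((i + 1 : ℕ) : ℤ) = a at *
    generalize qInt ((d + 1 : ℕ) : ℤ) = b at *
    field_simp

theorem prod_shift (k : ℕ) :
    (∏ i ∈ Finset.range (k + 1), (X - C (qInt i))).comp (C qq * X + 1) =
      (C qq * X + 1) * (C (qq ^ k) * ∏ i ∈ Finset.range k, (X - C (qInt i))) := by
  induction k with
  | zero => simp [qInt]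
  | succ k ih =>
    rw [Finset.prod_range_succ, mul_comp, ih, Finset.prod_range_succ _ k, qInt_succ]
    simp only [sub_comp, X_comp, C_comp]
    simp only [C_add, C_mul, C_1, pow_succ]
    ring

theorem Bq_zero : Bq 0 = 1 := by simp [Bq, qFact_zero]

theorem Bq_shift (k : ℕ) :
    (Bq (k + 1)).comp (C qq * X + 1) = C (qq ^ (k + 1)) * Bq (k + 1) + Bq k := by
  have hc : (k + 1).choose 2 = k + k.choose 2 := by
    rw [Nat.choose_succ_succ' k 1, Nat.choose_one_right]
  have hA : (qq ^ (k.choose 2) * qFact k)⁻¹ =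
      (qq ^ ((k + 1).choose 2) * qFact (k + 1))⁻¹ * (qq ^ k * (1 + qq * qInt (k : ℤ))) := by
    rw [← qInt_succ, hc, qFact_succ, pow_add]
    have h1 := qFact_ne k
    have h2 := qInt_succ_ne k
    have h3 := qq_ne_zero
    generalize qInt ((k + 1 : ℕ) : ℤ) = a at *
    field_simp
  unfold Bq
  rw [mul_comp, C_comp, prod_shift, hA, Finset.prod_range_succ]
  simp only [C_add, C_mul, C_1, pow_succ]
  ring

/-- `B_q(k - i)`, or zero for `i > k`. -/
def Bx (k i : ℕ) : K[X] := if i ≤ k then Bq (k - i) else 0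

theorem Bx_shift (k i : ℕ) :
    (Bx k i).comp (C qq * X + 1) = C (qq ^ (k - i)) * Bx k i + Bx k (i + 1) := by
  unfold Bx
  rcases lt_trichotomy i k with h | h | h
  · obtain ⟨d, rfl⟩ := Nat.exists_eq_add_of_lt h
    rw [if_pos (by omega), if_pos (by omega), show i + d + 1 - i = d + 1 by omega,
      show i + d + 1 - (i + 1) = d by omega, Bq_shift]
  · subst h; simp [Bq_zero]
  · rw [if_neg (by omega), if_neg (by omega)]; simp

theorem shift_aux (m k : ℕ) :
    (Bq k).comp (C (qq ^ m) * X + C (qInt (m : ℤ))) =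
      ∑ i ∈ Finset.range (m + 1), C (qq ^ ((m - i) * (k - i)) * qBinom m i) * Bx k i := by
  induction m with
  | zero => simp [qInt, qBinom_zero, Bx]
  | succ m ih =>
    have hcomp : (C (qq ^ (m + 1)) * X + C (qInt ((m + 1 : ℕ) : ℤ)) : K[X]) =
        (C (qq ^ m) * X + C (qInt (m : ℤ))).comp (C qq * X + 1) := by
      rw [qInt_succ']
      simp only [add_comp, mul_comp, C_comp, X_comp, C_add, C_mul, pow_succ]
      ring
    rw [hcomp, ← comp_assoc, ih, sum_comp]
    have h1 : ∀ i ∈ Finset.range (m + 1),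
        (C (qq ^ ((m - i) * (k - i)) * qBinom m i) * Bx k i).comp (C qq * X + 1) =
        C (qq ^ ((m + 1 - i) * (k - i)) * qBinom m i) * Bx k i +
        C (qq ^ ((m - i) * (k - i)) * qBinom m i) * Bx k (i + 1) := by
      intro i hi
      have hi' : i ≤ m := by simpa [Nat.lt_succ_iff] using hi
      rw [mul_comp, C_comp, Bx_shift, Nat.succ_sub hi', Nat.succ_mul, pow_add]
      simp only [C_mul]
      ring
    rw [Finset.sum_congr rfl h1, Finset.sum_add_distrib, Finset.sum_range_succ' _ (m + 1)]
    have h2 : ∀ i ∈ Finset.range (m + 1),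
        C (qq ^ ((m + 1 - (i + 1)) * (k - (i + 1))) * qBinom (m + 1) (i + 1)) * Bx k (i + 1) =
        C (qq ^ ((m + 1 - (i + 1)) * (k - (i + 1))) * qBinom m (i + 1)) * Bx k (i + 1) +
        C (qq ^ ((m - i) * (k - i)) * qBinom m i) * Bx k (i + 1) := by
      intro i hi
      have hi' : i ≤ m := by simpa [Nat.lt_succ_iff] using hi
      by_cases hk : i + 1 ≤ k
      · rw [qBinom_pascal m i hi', Nat.add_sub_add_right,
          show k - i = (k - (i + 1)) + 1 by omega, Nat.mul_succ, pow_add]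
        simp only [C_mul, C_add]
        ring
      · simp [Bx, hk]
    rw [Finset.sum_congr rfl h2, Finset.sum_add_distrib]
    have h3 : ∑ i ∈ Finset.range (m + 1),
        C (qq ^ ((m + 1 - i) * (k - i)) * qBinom m i) * Bx k i =
        ∑ i ∈ Finset.range (m + 1),
          C (qq ^ ((m + 1 - (i + 1)) * (k - (i + 1))) * qBinom m (i + 1)) * Bx k (i + 1) +
        C (qq ^ ((m + 1 - 0) * (k - 0)) * qBinom (m + 1) 0) * Bx k 0 := by
      have := Finset.sum_range_succ'
        (fun i => C (qq ^ ((m + 1 - i) * (k - i)) * qBinom m i) * Bx k i) (m + 1)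
      rw [Finset.sum_range_succ, qBinom_big] at this
      simp only [mul_zero, C_0, zero_mul, add_zero, qBinom_zero] at this ⊢
      exact this
    rw [h3]
    abel

/-- Action of the `m`-th power of the shift operator `S(x) = qx + 1` on the basis of
`q`-binomial coefficient polynomials:
`S^m B_q(k) = B_q(k)∘(q^m x + [m]_q) = Σ_{i=0}^{min(m,k)} q^{(m−i)(k−i)} qbinom(m,i) B_q(k−i)`. -/
theorem shift_pow_qbinomial (m k : ℕ) :
    (Bq k).comp (C (qq ^ m) * X + C (qInt (m : ℤ))) =
      ∑ i ∈ Finset.range (min m k + 1),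
        C (qq ^ ((m - i) * (k - i)) * qBinom m i) * Bq (k - i) := by
  rw [shift_aux]
  symm
  have hs : Finset.range (min m k + 1) ⊆ Finset.range (m + 1) :=
    Finset.range_subset_range.2 (by omega)
  rw [← Finset.sum_subset hs]
  · refine Finset.sum_congr rfl fun i hi => ?_
    rw [Finset.mem_range] at hi
    rw [Bx, if_pos (by omega)]
  · intro i hi hn
    rw [Finset.mem_range] at hi hn
    rw [Bx, if_neg (by omega), mul_zero]
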